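/- (Sanderson's dimension formula, first case.) The total mass of μ_{N,0} satisfies μ_{0,0}(Γ) = 1 and μ_{N,0}(Γ) = (m+1)·(m+n+1)^{N−1} for all N ≥ 1. -/

import Mathlib

open Finsupp Filter

noncomputable section

/-- Signed-sum convention: `signedSum c k = Σ_{i=0}^{k} c i`, which is the ordinary sum for
`k ≥ 0`, is `0` for `k = -1`, and equals `-(c (-1) + c (-2) + ⋯ + c (k+1))` for `k ≤ -2`. -/
def signedSum {M : Type*} [AddCommGroup M] (c : ℤ → M) (k : ℤ) : M :=
  (∑ i ∈ Finset.range (k + 1).toNat, c i) -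
    ∑ i ∈ Finset.range (-(k + 1)).toNat, c (-((i : ℤ) + 1))

/-- The Demazure operator `D₀` (relative to `Λ = mΛ₀ + nΛ₁`):
`D₀ δ_{(a,b)} = Σ_{i=0}^{m - 2(a-b)} δ_{(a+i,b)}`, extended ℤ-linearly. -/
def D0 (m : ℕ) (μ : ℤ × ℤ →₀ ℤ) : ℤ × ℤ →₀ ℤ :=
  μ.sum fun p c =>
    c • signedSum (fun i => Finsupp.single (p.1 + i, p.2) (1 : ℤ)) ((m : ℤ) - 2 * (p.1 - p.2))

/-- The Demazure operator `D₁` (relative to `Λ = mΛ₀ + nΛ₁`):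
`D₁ δ_{(a,b)} = Σ_{i=0}^{n + 2(a-b)} δ_{(a,b+i)}`, extended ℤ-linearly. -/
def D1 (n : ℕ) (μ : ℤ × ℤ →₀ ℤ) : ℤ × ℤ →₀ ℤ :=
  μ.sum fun p c =>
    c • signedSum (fun i => Finsupp.single (p.1, p.2 + i) (1 : ℤ)) ((n : ℤ) + 2 * (p.1 - p.2))

/-- Total mass `μ(Γ)` of a finitely supported function on `ℤ × ℤ`. -/
def mass (μ : ℤ × ℤ →₀ ℤ) : ℤ := μ.sum fun _ c => c

/-- Expected value `E_ν[f] = (1/ν(Γ)) Σ ν(a,b) f(a,b)`. -/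
def expVal (ν : ℤ × ℤ →₀ ℤ) (f : ℤ × ℤ → ℚ) : ℚ :=
  (mass ν : ℚ)⁻¹ * ν.sum fun p c => (c : ℚ) * f p

/-- Covariance `Cov_ν(f,g) = E_ν[f·g] - E_ν[f]·E_ν[g]`. -/
def cov (ν : ℤ × ℤ →₀ ℤ) (f g : ℤ × ℤ → ℚ) : ℚ :=
  expVal ν (fun p => f p * g p) - expVal ν f * expVal ν g

/-- Variance `Var_ν(f) = Cov_ν(f,f)`. -/
def var (ν : ℤ × ℤ →₀ ℤ) (f : ℤ × ℤ → ℚ) : ℚ := cov ν f f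

/-- The coordinate function `a` (the degree). -/
def fa : ℤ × ℤ → ℚ := fun p => (p.1 : ℚ)

/-- The coordinate function `b`. -/
def fb : ℤ × ℤ → ℚ := fun p => (p.2 : ℚ)

/-- The finite-weight coordinate `a - b`. -/
def fab : ℤ × ℤ → ℚ := fun p => (p.1 : ℚ) - (p.2 : ℚ)

/-- `μ_{N,0}`: start from `δ_{(0,0)}`, apply `D₀` at odd steps and `D₁` at even steps. -/
def mu0 (m n : ℕ) : ℕ → (ℤ × ℤ →₀ ℤ)
  | 0 => Finsupp.single (0, 0) 1
  | N + 1 => if N % 2 = 0 then D0 m (mu0 m n N) else D1 n (mu0 m n N)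

/-- `μ_{N,1}`: start from `δ_{(0,0)}`, apply `D₁` at odd steps and `D₀` at even steps. -/
def mu1 (m n : ℕ) : ℕ → (ℤ × ℤ →₀ ℤ)
  | 0 => Finsupp.single (0, 0) 1
  | N + 1 => if N % 2 = 0 then D1 n (mu1 m n N) else D0 m (mu1 m n N)

lemma map_signedSum {M N : Type*} [AddCommGroup M] [AddCommGroup N]
    (φ : M →ₗ[ℤ] N) (c : ℤ → M) (k : ℤ) :
    φ (signedSum c k) = signedSum (fun i => φ (c i)) k := by
  simp [signedSum, map_sub, map_sum]

/-- The signed sum of an arithmetic progression. -/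
lemma signedSum_affine (c e k : ℤ) :
    signedSum (fun i => c + 2 * e * i) k = (k + 1) * (c + e * k) := by
  have hpos (t : ℕ) : ∑ i ∈ Finset.range t, (c + 2 * e * (i : ℤ)) = t * (c + e * (t - 1)) := by
    induction t with
    | zero => simp
    | succ t ih => rw [Finset.sum_range_succ, ih]; push_cast; ring
  have hneg (t : ℕ) : ∑ i ∈ Finset.range t, (c + 2 * e * (-((i : ℤ) + 1))) =
      t * (c - e * (t + 1)) := by
    induction t with
    | zero => simp
    | succ t ih => rw [Finset.sum_range_succ, ih]; push_cast; ring
  unfold signedSum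
  rw [hpos, hneg]
  obtain h | h := le_total 0 (k + 1)
  · rw [Int.toNat_of_nonneg h, Int.toNat_of_nonpos (by linarith)]
    push_cast
    ring
  · rw [Int.toNat_of_nonpos h, Int.toNat_of_nonneg (by linarith)]
    push_cast
    ring

lemma signedSum_one (k : ℤ) : signedSum (fun _ => (1 : ℤ)) k = k + 1 := by
  simpa using signedSum_affine 1 0 k

lemma mass_eq_linearCombination (μ : ℤ × ℤ →₀ ℤ) :
    mass μ = linearCombination ℤ (fun _ => (1 : ℤ)) μ := by
  simp [mass, linearCombination_apply]

lemma linearCombination_D0 (m : ℕ) (f : ℤ × ℤ → ℤ) (μ : ℤ × ℤ →₀ ℤ) :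
    linearCombination ℤ f (D0 m μ) = linearCombination ℤ
      (fun p => signedSum (fun i => f (p.1 + i, p.2)) ((m : ℤ) - 2 * (p.1 - p.2))) μ := by
  simp only [D0, map_finsuppSum, map_smul, map_signedSum, linearCombination_single, one_smul]
  rfl

lemma linearCombination_D1 (n : ℕ) (f : ℤ × ℤ → ℤ) (μ : ℤ × ℤ →₀ ℤ) :
    linearCombination ℤ f (D1 n μ) = linearCombination ℤ
      (fun p => signedSum (fun i => f (p.1, p.2 + i)) ((n : ℤ) + 2 * (p.1 - p.2))) μ := by
  simp only [D1, map_finsuppSum, map_smul, map_signedSum, linearCombination_single, one_smul]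
  rfl

/-- The image of `D₀` is symmetric about `2 (a - b) = m`, to first order. -/
lemma linearCombination_D0_centered (m : ℕ) (μ : ℤ × ℤ →₀ ℤ) :
    linearCombination ℤ (fun p : ℤ × ℤ => 2 * (p.1 - p.2) - (m : ℤ)) (D0 m μ) = 0 := by
  have h (p : ℤ × ℤ) : signedSum (fun i => 2 * (p.1 + i - p.2) - (m : ℤ))
      ((m : ℤ) - 2 * (p.1 - p.2)) = 0 := by
    convert signedSum_affine (2 * (p.1 - p.2) - m) 1 (m - 2 * (p.1 - p.2)) using 1
    · congr 1; ext i; ring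
    · ring
  rw [linearCombination_D0]
  simp [h, linearCombination_apply]

/-- The image of `D₁` is symmetric about `2 (a - b) = -n`, to first order. -/
lemma linearCombination_D1_centered (n : ℕ) (μ : ℤ × ℤ →₀ ℤ) :
    linearCombination ℤ (fun p : ℤ × ℤ => 2 * (p.1 - p.2) + (n : ℤ)) (D1 n μ) = 0 := by
  have h (p : ℤ × ℤ) : signedSum (fun i => 2 * (p.1 - (p.2 + i)) + (n : ℤ))
      ((n : ℤ) + 2 * (p.1 - p.2)) = 0 := by
    convert signedSum_affine (2 * (p.1 - p.2) + n) (-1) (n + 2 * (p.1 - p.2)) using 1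
    · congr 1; ext i; ring
    · ring
  rw [linearCombination_D1]
  simp [h, linearCombination_apply]

lemma mass_D0 (m : ℕ) (c : ℤ) (μ : ℤ × ℤ →₀ ℤ) :
    mass (D0 m μ) = (m + c + 1) * mass μ -
      linearCombination ℤ (fun p : ℤ × ℤ => 2 * (p.1 - p.2) + c) μ := by
  simp only [mass_eq_linearCombination, linearCombination_D0, signedSum_one]
  simp only [linearCombination_apply, Finsupp.sum, smul_eq_mul, Finset.mul_sum,
    ← Finset.sum_sub_distrib]
  exact Finset.sum_congr rfl fun p _ => by ring

lemma mass_D1 (n : ℕ) (c : ℤ) (μ : ℤ × ℤ →₀ ℤ) :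
    mass (D1 n μ) = (c + n + 1) * mass μ +
      linearCombination ℤ (fun p : ℤ × ℤ => 2 * (p.1 - p.2) - c) μ := by
  simp only [mass_eq_linearCombination, linearCombination_D1, signedSum_one]
  simp only [linearCombination_apply, Finsupp.sum, smul_eq_mul, Finset.mul_sum,
    ← Finset.sum_add_distrib]
  exact Finset.sum_congr rfl fun p _ => by ring

lemma mass_D1_D0 (m n : ℕ) (μ : ℤ × ℤ →₀ ℤ) :
    mass (D1 n (D0 m μ)) = (m + n + 1) * mass (D0 m μ) := by
  rw [mass_D1 n m, linearCombination_D0_centered, add_zero]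

lemma mass_D0_D1 (m n : ℕ) (μ : ℤ × ℤ →₀ ℤ) :
    mass (D0 m (D1 n μ)) = (m + n + 1) * mass (D1 n μ) := by
  rw [mass_D0 m n, linearCombination_D1_centered, sub_zero]

lemma mass_mu0_add_two (m n N : ℕ) :
    mass (mu0 m n (N + 2)) = (m + n + 1) * mass (mu0 m n (N + 1)) := by
  obtain h | h := Nat.mod_two_eq_zero_or_one N
  · simp [mu0, h, show (N + 1) % 2 = 1 by lia, mass_D1_D0]
  · simp [mu0, h, show (N + 1) % 2 = 0 by lia, mass_D0_D1]

/-- Sanderson's dimension formula, first case: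
`μ_{0,0}(Γ) = 1` and `μ_{N,0}(Γ) = (m+1)(m+n+1)^{N-1}` for `N ≥ 1`. -/
theorem stmt_5 (m n : ℕ) :
    mass (mu0 m n 0) = 1 ∧
    ∀ N : ℕ, 1 ≤ N →
      mass (mu0 m n N) = ((m : ℤ) + 1) * ((m : ℤ) + (n : ℤ) + 1) ^ (N - 1) := by
  have h0 : mass (mu0 m n 0) = 1 := by simp [mass, mu0]
  refine ⟨h0, fun N hN => ?_⟩
  induction N, hN using Nat.le_induction with
  | base =>
    have h1 : mu0 m n 1 = D0 m (mu0 m n 0) := by simp [mu0]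
    rw [h1, mass_D0 m 0, h0]
    simp [mu0]
  | succ N hN ih =>
    obtain ⟨N, rfl⟩ := Nat.exists_eq_add_of_le' hN
    rw [mass_mu0_add_two, ih]
    simp only [Nat.add_sub_cancel]
    ring
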